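/- arXiv:0810.1076 — 3 statements merged into one kernel-verified Lean document; each statement's English description precedes it below -/
import Mathlib

section
/- Let φ : ℝ² → ℂ be continuous and let A₀ : ℝ² → ℝ be a twice continuously differentiable solution of ΔA₀ = |φ|² A₀ on all of ℝ² satisfying ∫_{ℝ²} |∇A₀|² dx < ∞. Then A₀ is constant. Moreover, if φ is not identically zero, then A₀ ≡ 0. -/
/-!
The Julia–Zee theorem, basic version (Proposition 2.1 of Spruck–Yang):
a finite Dirichlet energy solution of the static Gauss law ΔA₀ = |φ|² A₀
on ℝ² is constant, and vanishes identically when φ does not.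
-/

open MeasureTheory

noncomputable section

/-- The plane ℝ². -/
abbrev Plane : Type := EuclideanSpace ℝ (Fin 2)

/-- Partial derivative in the `i`-th coordinate direction. -/
def pd (i : Fin 2) (f : Plane → ℝ) (x : Plane) : ℝ :=
  fderiv ℝ f x (EuclideanSpace.single i 1)

/-- The Laplacian on ℝ²: Δf = ∂₁²f + ∂₂²f. -/
def lap (f : Plane → ℝ) (x : Plane) : ℝ :=
  pd 0 (pd 0 f) x + pd 1 (pd 1 f) x

theorem continuous_pd {f : Plane → ℝ} (hf : ContDiff ℝ 1 f) (i : Fin 2) :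
    Continuous (pd i f) :=
  (hf.continuous_fderiv one_ne_zero).clm_apply continuous_const

theorem contDiff_pd {f : Plane → ℝ} (hf : ContDiff ℝ 2 f) (i : Fin 2) :
    ContDiff ℝ 1 (pd i f) :=
  (hf.fderiv_right (m := 1) (by norm_num)).clm_apply contDiff_const

theorem norm_gradient_sq (f : Plane → ℝ) (x : Plane) :
    ‖gradient f x‖ ^ 2 = pd 0 f x ^ 2 + pd 1 f x ^ 2 := by
  have h (i : Fin 2) : gradient f x i = pd i f x := by
    have := InnerProductSpace.toDual_symm_apply (𝕜 := ℝ) (x := EuclideanSpace.single i (1 : ℝ))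
      (y := fderiv ℝ f x)
    rw [EuclideanSpace.inner_single_right] at this
    simpa [gradient, pd] using this
  rw [EuclideanSpace.real_norm_sq_eq, Fin.sum_univ_two, h, h]

theorem abs_pd_le (f : Plane → ℝ) (x : Plane) (i : Fin 2) : |pd i f x| ≤ ‖fderiv ℝ f x‖ := by
  simpa [pd] using (fderiv ℝ f x).le_opNorm (EuclideanSpace.single i 1)

theorem hasCompactSupport_pd {f : Plane → ℝ} (hf : HasCompactSupport f) (i : Fin 2) :
    HasCompactSupport (pd i f) :=
  hf.fderiv_apply ℝ _

theorem integral_mul_pd_add_pd_mul {f g : Plane → ℝ} (hf : ContDiff ℝ 1 f)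
    (hfs : HasCompactSupport f) (hg : ContDiff ℝ 1 g) (i : Fin 2) :
    Integrable (fun x => f x * pd i g x + pd i f x * g x) ∧
      ∫ x, (f x * pd i g x + pd i f x * g x) = 0 := by
  have h₁ : Integrable (fun x => f x * pd i g x) :=
    (hf.continuous.mul (continuous_pd hg i)).integrable_of_hasCompactSupport hfs.mul_right
  have h₂ : Integrable (fun x => pd i f x * g x) :=
    ((continuous_pd hf i).mul hg.continuous).integrable_of_hasCompactSupport
      (hasCompactSupport_pd hfs i).mul_right
  have h₃ : Integrable (fun x => f x * g x) :=
    (hf.continuous.mul hg.continuous).integrable_of_hasCompactSupport hfs.mul_right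
  refine ⟨h₁.add h₂, ?_⟩
  rw [integral_add h₁ h₂, add_eq_zero_iff_eq_neg]
  exact integral_mul_fderiv_eq_neg_fderiv_mul_of_integrable h₂ h₁ h₃
    (fun x _ => hf.differentiable one_ne_zero x) (fun x _ => hg.differentiable one_ne_zero x)

theorem pd_mul_arctan {η A : Plane → ℝ} (hη : ContDiff ℝ 1 η) (hA : ContDiff ℝ 1 A)
    (i : Fin 2) (x : Plane) :
    pd i (fun y => η y * Real.arctan (A y)) x =
      pd i η x * Real.arctan (A x) + η x * (pd i A x / (1 + A x ^ 2)) := by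
  have hηx := (hη.differentiable one_ne_zero x).hasFDerivAt
  have hAx := (hA.differentiable one_ne_zero x).hasFDerivAt.arctan
  rw [pd, (hηx.fun_mul hAx).fderiv]
  simp [pd]
  ring

/-- Caccioppoli-type inequality obtained by testing with `η * arctan A`. -/
theorem integral_mul_energy_le {η A : Plane → ℝ} (hη : ContDiff ℝ 1 η)
    (hηs : HasCompactSupport η) (hη₀ : ∀ x, 0 ≤ η x) (hA : ContDiff ℝ 2 A)
    (hsign : ∀ x, 0 ≤ lap A x * Real.arctan (A x)) {g : Plane → ℝ} (hg : Integrable g)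
    (hle : ∀ x, -(Real.arctan (A x) * (pd 0 η x * pd 0 A x + pd 1 η x * pd 1 A x)) ≤ g x) :
    ∫ x, η x * ((pd 0 A x ^ 2 + pd 1 A x ^ 2) / (1 + A x ^ 2)) ≤ ∫ x, g x := by
  have hA₁ : ContDiff ℝ 1 A := hA.of_le (by norm_num)
  have hat : ContDiff ℝ 1 (fun x => Real.arctan (A x)) := hA₁.arctan
  have key (i : Fin 2) := integral_mul_pd_add_pd_mul (hη.mul hat) hηs.mul_right (contDiff_pd hA i) i
  have hc (i : Fin 2) := continuous_pd hA₁ i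
  have hL : Integrable fun x => η x * ((pd 0 A x ^ 2 + pd 1 A x ^ 2) / (1 + A x ^ 2)) :=
    (hη.continuous.mul ((((hc 0).pow 2).add ((hc 1).pow 2)).div
      (continuous_const.add (hA.continuous.pow 2)) fun x => (by positivity : 1 + A x ^ 2 ≠ 0))
      ).integrable_of_hasCompactSupport hηs.mul_right
  have hK := (key 0).1.fun_add (key 1).1
  have hK₀ := integral_add (key 0).1 (key 1).1
  rw [(key 0).2, (key 1).2, add_zero] at hK₀
  rw [← add_zero (∫ x, g x), ← hK₀, ← integral_add hg hK]
  refine integral_mono hL (hg.add hK) fun x => (?_ : _ ≤ _).trans (add_le_add_left (hle x) _)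
  simp only [pd_mul_arctan hη hA₁]
  have h := mul_nonneg (hη₀ x) (hsign x)
  rw [lap] at h
  refine sub_nonneg.1 (h.trans_eq ?_)
  ring

/-- Cutoff functions at scale `n`, with gradient of size `1 / n` in an annulus. -/
theorem exists_cutoff :
    ∃ (η : ℕ → Plane → ℝ) (C : ℝ), ∀ n : ℕ, 0 < n →
      ContDiff ℝ 1 (η n) ∧ HasCompactSupport (η n) ∧ (∀ x, 0 ≤ η n x) ∧ (∀ x, η n x ≤ 1) ∧
      (∀ x, ‖x‖ < n → η n x = 1) ∧ (∀ x, ‖fderiv ℝ (η n) x‖ ≤ C / n) ∧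
      (∀ x, ‖x‖ < n → fderiv ℝ (η n) x = 0) ∧
      (∀ x, 2 * n < ‖x‖ → fderiv ℝ (η n) x = 0) := by
  let b : ContDiffBump (0 : Plane) := ⟨1, 2, one_pos, one_lt_two⟩
  have hb : ContDiff ℝ 1 b := b.contDiff
  obtain ⟨C, hC⟩ := (hb.continuous_fderiv one_ne_zero).bounded_above_of_compact_support
    (b.hasCompactSupport.fderiv ℝ)
  refine ⟨fun n x => b ((n : ℝ)⁻¹ • x), C, fun n hn => ?_⟩
  have hn' : (0 : ℝ) < n := by exact_mod_cast hn
  have hnorm (x : Plane) : ‖(n : ℝ)⁻¹ • x‖ = ‖x‖ / n := by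
    rw [norm_smul, norm_inv, Real.norm_of_nonneg hn'.le]; ring
  have hone (x : Plane) (hx : ‖x‖ < n) : b ((n : ℝ)⁻¹ • x) = 1 := by
    apply b.one_of_mem_closedBall
    rw [mem_closedBall_zero_iff, hnorm]
    exact (div_le_one hn').2 hx.le
  have hzero (x : Plane) (hx : 2 * n < ‖x‖) : b ((n : ℝ)⁻¹ • x) = 0 := by
    apply b.zero_of_le_dist
    rw [dist_zero_right, hnorm]
    exact (le_div_iff₀ hn').2 hx.le
  refine ⟨hb.comp (contDiff_const_smul _),
    b.hasCompactSupport.comp_smul (inv_ne_zero hn'.ne'),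
    fun x => b.nonneg, fun x => b.le_one, hone, fun x => ?_, fun x hx => ?_, fun x hx => ?_⟩
  · rw [fderiv_comp_smul, norm_smul, norm_inv, Real.norm_of_nonneg hn'.le, div_eq_inv_mul]
    gcongr
    exact hC _
  · have : (fun y : Plane => b ((n : ℝ)⁻¹ • y)) =ᶠ[nhds x] fun _ => 1 := by
      filter_upwards [(isOpen_lt continuous_norm continuous_const).mem_nhds hx] with y hy
      exact hone y hy
    rw [this.fderiv_eq, fderiv_const_apply]
  · have : (fun y : Plane => b ((n : ℝ)⁻¹ • y)) =ᶠ[nhds x] fun _ => 0 := by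
      filter_upwards [(isOpen_lt continuous_const continuous_norm).mem_nhds hx] with y hy
      exact hzero y hy
    rw [this.fderiv_eq, fderiv_const_apply]

theorem volume_real_closedBall_plane {r : ℝ} (hr : 0 ≤ r) :
    volume.real (Metric.closedBall (0 : Plane) r) = Real.pi * r ^ 2 := by
  simp [Measure.real, EuclideanSpace.volume_closedBall_fin_two, hr, mul_comm, Real.pi_nonneg]

/-- The pointwise bound of the flux term by a weighted arithmetic-geometric mean. -/
theorem neg_arctan_mul_le {t p q u v d ε : ℝ} (hε : 0 < ε) (hp : |p| ≤ d) (hq : |q| ≤ d) :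
    -(Real.arctan t * (p * u + q * v)) ≤ 2 * (2 * ε * d ^ 2 + ε⁻¹ * (u ^ 2 + v ^ 2)) := by
  have ht : |Real.arctan t| ≤ 2 := by
    rw [abs_le]
    have h₁ := Real.neg_pi_div_two_lt_arctan t
    have h₂ := Real.arctan_lt_pi_div_two t
    have h₃ := Real.pi_le_four
    constructor <;> linarith
  have amgm (a b : ℝ) (ha : |a| ≤ d) : |a * b| ≤ ε * d ^ 2 + ε⁻¹ * b ^ 2 := by
    have h := sq_nonneg (ε * |a| - |b|)
    have h₁ : |a| ^ 2 ≤ d ^ 2 := by gcongr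
    have h₂ : |b| ^ 2 = b ^ 2 := sq_abs b
    have h₃ := mul_nonneg (abs_nonneg a) (abs_nonneg b)
    rw [abs_mul, ← h₂]
    have : |a| * |b| ≤ ε * |a| ^ 2 + ε⁻¹ * |b| ^ 2 := by
      have h₄ : 0 ≤ ε⁻¹ * (ε * |a| - |b|) ^ 2 := by positivity
      have h₅ : ε⁻¹ * (ε * |a| - |b|) ^ 2 = ε * |a| ^ 2 + ε⁻¹ * |b| ^ 2 - 2 * (|a| * |b|) := by
        field_simp
        ring
      linarith
    have := mul_le_mul_of_nonneg_left h₁ hε.le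
    linarith
  calc -(Real.arctan t * (p * u + q * v)) ≤ |Real.arctan t * (p * u + q * v)| := neg_le_abs _
    _ = |Real.arctan t| * |p * u + q * v| := abs_mul _ _
    _ ≤ 2 * (|p * u| + |q * v|) := by gcongr; exact abs_add_le _ _
    _ ≤ _ := by linarith [amgm p u hp, amgm q v hq]

theorem pd_eq_zero_of_lap_mul_arctan_nonneg {A : Plane → ℝ} (hA : ContDiff ℝ 2 A)
    (hsign : ∀ x, 0 ≤ lap A x * Real.arctan (A x))
    (hfin : Integrable fun x => pd 0 A x ^ 2 + pd 1 A x ^ 2) (x : Plane) :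
    pd 0 A x ^ 2 + pd 1 A x ^ 2 = 0 := by
  set G : Plane → ℝ := fun x => pd 0 A x ^ 2 + pd 1 A x ^ 2 with hG
  have hA₁ : ContDiff ℝ 1 A := hA.of_le (by norm_num)
  have hG₀ (x) : 0 ≤ G x := by simp only [hG]; positivity
  have hGc : Continuous G := ((continuous_pd hA₁ 0).pow 2).add ((continuous_pd hA₁ 1).pow 2)
  have hhc : Continuous fun x => G x / (1 + A x ^ 2) :=
    hGc.div (continuous_const.add (hA.continuous.pow 2)) fun x => by positivity
  have hh₀ (x) : 0 ≤ G x / (1 + A x ^ 2) := div_nonneg (hG₀ x) (by positivity)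
  have hhle (x) : G x / (1 + A x ^ 2) ≤ G x :=
    div_le_self (hG₀ x) (le_add_of_nonneg_right (sq_nonneg _))
  have hhi : Integrable fun x => G x / (1 + A x ^ 2) :=
    hfin.mono' hhc.aestronglyMeasurable
      (.of_forall fun x => by rw [Real.norm_of_nonneg (hh₀ x)]; exact hhle x)
  obtain ⟨η, C, hη⟩ := exists_cutoff
  have hlim : Filter.Tendsto (fun n => ∫ x, η n x * (G x / (1 + A x ^ 2))) Filter.atTop
      (nhds (∫ x, G x / (1 + A x ^ 2))) := by
    refine tendsto_integral_filter_of_dominated_convergence G ?_ ?_ hfin (.of_forall fun x => ?_)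
    · filter_upwards [Filter.eventually_gt_atTop 0] with n hn
      exact ((hη n hn).1.continuous.mul hhc).aestronglyMeasurable
    · filter_upwards [Filter.eventually_gt_atTop 0] with n hn
      refine .of_forall fun x => ?_
      obtain ⟨-, -, h₀, h₁, -⟩ := hη n hn
      rw [Real.norm_of_nonneg (mul_nonneg (h₀ x) (hh₀ x))]
      exact (mul_le_of_le_one_left (hh₀ x) (h₁ x)).trans (hhle x)
    · refine tendsto_const_nhds.congr' ?_
      obtain ⟨N, hN⟩ := exists_nat_gt ‖x‖
      filter_upwards [Filter.eventually_gt_atTop 0, Filter.eventually_ge_atTop N] with n hn hNn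
      rw [(hη n hn).2.2.2.2.1 x (hN.trans_le (by exact_mod_cast hNn)), one_mul]
  have hSm (n : ℕ) : MeasurableSet {x : Plane | (n : ℝ) ≤ ‖x‖} :=
    (isClosed_le continuous_const continuous_norm).measurableSet
  have htail : Filter.Tendsto (fun n : ℕ => ∫ x, {x : Plane | (n : ℝ) ≤ ‖x‖}.indicator G x)
      Filter.atTop (nhds 0) := by
    rw [← integral_zero Plane ℝ (μ := volume)]
    refine tendsto_integral_of_dominated_convergence G
      (fun n => (hfin.indicator (hSm n)).aestronglyMeasurable) hfin
      (fun n => .of_forall fun x => ?_) (.of_forall fun x => ?_)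
    · exact (norm_indicator_le_norm_self G x).trans_eq (Real.norm_of_nonneg (hG₀ x))
    · refine tendsto_const_nhds.congr' ?_
      obtain ⟨N, hN⟩ := exists_nat_gt ‖x‖
      filter_upwards [Filter.eventually_ge_atTop N] with n hNn
      have : ‖x‖ < n := hN.trans_le (by exact_mod_cast hNn)
      rw [Set.indicator_of_notMem (by simpa using this)]
  have hbound (ε : ℝ) (hε : 0 < ε) (n : ℕ) (hn : 0 < n) :
      ∫ x, η n x * (G x / (1 + A x ^ 2)) ≤
        16 * Real.pi * C ^ 2 * ε +
          2 * ε⁻¹ * ∫ x, {x : Plane | (n : ℝ) ≤ ‖x‖}.indicator G x := by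
    obtain ⟨hη₁, hηs, hη₀, -, -, hC, hin, hout⟩ := hη n hn
    have hn' : (0 : ℝ) < n := by exact_mod_cast hn
    have hBi : Integrable ((Metric.closedBall (0 : Plane) (2 * n)).indicator
        fun _ => 4 * ε * (C / n) ^ 2) :=
      (integrable_indicator_iff Metric.isClosed_closedBall.measurableSet).2
        (integrableOn_const measure_closedBall_lt_top.ne)
    have hTi := (hfin.indicator (hSm n)).const_mul (2 * ε⁻¹)
    have hBv : ∫ x, (Metric.closedBall (0 : Plane) (2 * n)).indicator
        (fun _ => 4 * ε * (C / n) ^ 2) x = 16 * Real.pi * C ^ 2 * ε := by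
      rw [integral_indicator Metric.isClosed_closedBall.measurableSet, setIntegral_const,
        volume_real_closedBall_plane (by positivity), smul_eq_mul]
      field_simp
      ring
    rw [← hBv, ← integral_const_mul, ← integral_add hBi hTi]
    refine integral_mul_energy_le hη₁ hηs hη₀ hA hsign (hBi.add hTi) fun x => ?_
    rcases lt_or_ge ‖x‖ n with hx | hx
    · simp only [pd, hin x hx, zero_apply, zero_mul, add_zero, mul_zero, neg_zero]
      refine add_nonneg (Set.indicator_nonneg (fun _ _ => by positivity) x) ?_
      exact mul_nonneg (by positivity) (Set.indicator_nonneg (fun y _ => hG₀ y) x)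
    have hxT : {x : Plane | (n : ℝ) ≤ ‖x‖}.indicator G x = G x :=
      Set.indicator_of_mem (s := {x : Plane | (n : ℝ) ≤ ‖x‖}) hx G
    rw [hxT]
    rcases le_or_gt ‖x‖ (2 * n) with hx' | hx'
    · rw [Set.indicator_of_mem (mem_closedBall_zero_iff.2 hx')]
      refine (neg_arctan_mul_le hε ((abs_pd_le _ _ _).trans (hC x))
        ((abs_pd_le _ _ _).trans (hC x))).trans_eq ?_
      simp only [hG]
      ring
    · simp only [pd, hout x hx', zero_apply, zero_mul, add_zero, mul_zero, neg_zero]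
      refine add_nonneg (Set.indicator_nonneg (fun _ _ => by positivity) x) ?_
      exact mul_nonneg (by positivity) (hG₀ x)
  have hle (ε : ℝ) (hε : 0 < ε) : ∫ x, G x / (1 + A x ^ 2) ≤ 16 * Real.pi * C ^ 2 * ε := by
    have h := (htail.const_mul (2 * ε⁻¹)).const_add (16 * Real.pi * C ^ 2 * ε)
    rw [mul_zero, add_zero] at h
    refine le_of_tendsto_of_tendsto hlim h ?_
    filter_upwards [Filter.eventually_gt_atTop 0] with n hn using hbound ε hε n hn
  have hint : ∫ x, G x / (1 + A x ^ 2) = 0 := by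
    refine le_antisymm ?_ (integral_nonneg hh₀)
    have h : Filter.Tendsto (fun ε : ℝ => 16 * Real.pi * C ^ 2 * ε) (nhdsWithin 0 (Set.Ioi 0))
        (nhds (16 * Real.pi * C ^ 2 * 0)) :=
      (continuous_const_mul _).continuousWithinAt
    rw [mul_zero] at h
    exact ge_of_tendsto h (by filter_upwards [self_mem_nhdsWithin] with ε hε using hle ε hε)
  have hae := (integral_eq_zero_iff_of_nonneg hh₀ hhi).1 hint
  have hx := congrFun ((hhc.ae_eq_iff_eq volume continuous_zero).1 hae) x
  exact (div_eq_zero_iff.1 hx).resolve_right (by positivity)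

theorem julia_zee_basic (φ : Plane → ℂ) (A₀ : Plane → ℝ)
    (hφ : Continuous φ) (hA₀ : ContDiff ℝ 2 A₀)
    (heq : ∀ x, lap A₀ x = ‖φ x‖ ^ 2 * A₀ x)
    (hfin : Integrable (fun x => ‖gradient A₀ x‖ ^ 2)) :
    (∃ c : ℝ, ∀ x, A₀ x = c) ∧ ((∃ x, φ x ≠ 0) → ∀ x, A₀ x = 0) := by
  have hsign (x : Plane) : 0 ≤ lap A₀ x * Real.arctan (A₀ x) := by
    rw [heq, mul_assoc]
    refine mul_nonneg (sq_nonneg _) ?_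
    rcases le_total 0 (A₀ x) with h | h
    · exact mul_nonneg h (Real.arctan_nonneg.2 h)
    · exact mul_nonneg_of_nonpos_of_nonpos h (Real.arctan_le_zero.2 h)
  have hgrad (x : Plane) : ‖gradient A₀ x‖ ^ 2 = 0 := by
    rw [norm_gradient_sq]
    simp only [norm_gradient_sq] at hfin
    exact pd_eq_zero_of_lap_mul_arctan_nonneg hA₀ hsign hfin x
  have hconst (x y : Plane) : A₀ x = A₀ y := by
    refine is_const_of_fderiv_eq_zero (𝕜 := ℝ) (hA₀.differentiable two_ne_zero) (fun x => ?_) x y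
    have h : gradient A₀ x = 0 := norm_eq_zero.1 (pow_eq_zero_iff two_ne_zero |>.1 (hgrad x))
    simpa [gradient] using h
  refine ⟨⟨A₀ 0, fun x => hconst x 0⟩, fun ⟨y, hy⟩ x => ?_⟩
  have hA : A₀ = fun _ => A₀ y := funext fun z => hconst z y
  have hp (i : Fin 2) : pd i A₀ = fun _ => 0 := by
    rw [hA]
    funext z
    simp [pd]
  have h := heq y
  rw [lap, hp, hp] at h
  rw [hconst x y]
  simpa [pd, hy] using h.symm

end
end

section
/- Let Ω ⊂ ℝ² be open, let A : Ω → ℝ³ be continuously differentiable, let M > 0, and let U = {x ∈ Ω : |A(x)| > M}. Then the truncated field A^M = M A/|A| is continuously differentiable on U and satisfies, for each i = 1,2 and each x ∈ U, ∂_iA^M(x) · ∂_iA(x) = (|A(x)|/M) |∂_iA^M(x)|². -/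
/-!
The key pointwise identity for the radial truncation A^M = M A/|A| of a
vector field on the set where |A| > M:
∂ᵢA^M · ∂ᵢA = (|A|/M) |∂ᵢA^M|².
-/

open scoped RealInnerProductSpace

noncomputable section

/-- Euclidean ℝ³. -/
abbrev V3 : Type := EuclideanSpace ℝ (Fin 3)

section RadialTruncation

variable {E F : Type*} [NormedAddCommGroup E] [NormedSpace ℝ E]
  [NormedAddCommGroup F] [InnerProductSpace ℝ F]

/-- A differentiable map whose norm is locally constant is orthogonal to its derivative. -/
lemma inner_fderiv_eq_zero_of_norm_eventually_eq {f : E → F} {x : E} {c : ℝ}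
    (hf : DifferentiableAt ℝ f x) (hc : ∀ᶠ y in nhds x, ‖f y‖ = c) (v : E) :
    ⟪f x, fderiv ℝ f x v⟫ = 0 := by
  have h₁ := hf.hasFDerivAt.norm_sq
  have h₂ : HasFDerivAt (fun y => ‖f y‖ ^ 2) (0 : E →L[ℝ] ℝ) x :=
    (hasFDerivAt_const (c ^ 2) x).congr_of_eventuallyEq
      (hc.mono fun y hy => by simp only [hy])
  have h₃ := DFunLike.congr_fun (h₁.unique h₂) v
  simpa using h₃

lemma differentiableAt_div_norm {f : E → F} {x : E} (hf : DifferentiableAt ℝ f x)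
    (hx : f x ≠ 0) (M : ℝ) : DifferentiableAt ℝ (fun y => M / ‖f y‖) x := by
  have hn : DifferentiableAt ℝ (fun y => ‖f y‖) x := hf.norm ℝ hx
  simp only [div_eq_mul_inv]
  exact (hn.fun_inv (norm_ne_zero_iff.mpr hx)).const_mul M

lemma inner_fderiv_radial_truncation {f : E → F} {x : E} (hf : DifferentiableAt ℝ f x)
    (hx : f x ≠ 0) {M : ℝ} (hM : 0 < M) (v : E) :
    ⟪fderiv ℝ (fun y => (M / ‖f y‖) • f y) x v, fderiv ℝ f x v⟫
      = (‖f x‖ / M) * ‖fderiv ℝ (fun y => (M / ‖f y‖) • f y) x v‖ ^ 2 := by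
  have hg := differentiableAt_div_norm hf hx M
  have hn : 0 < ‖f x‖ := norm_pos_iff.mpr hx
  have hnorm : ∀ᶠ y in nhds x, ‖(M / ‖f y‖) • f y‖ = M := by
    filter_upwards [hf.continuousAt.eventually_ne hx] with y hy
    rw [norm_smul, norm_div, norm_norm, Real.norm_of_nonneg hM.le,
      div_mul_cancel₀ _ (norm_ne_zero_iff.mpr hy)]
  have horth := inner_fderiv_eq_zero_of_norm_eventually_eq (hg.smul hf) hnorm v
  have hprod : fderiv ℝ (fun y => (M / ‖f y‖) • f y) x v
      = (M / ‖f x‖) • fderiv ℝ f x v + (fderiv ℝ (fun y => M / ‖f y‖) x v) • f x := by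
    rw [fderiv_fun_smul hg hf]
    simp
  change ⟪(M / ‖f x‖) • f x, fderiv ℝ (fun y => (M / ‖f y‖) • f y) x v⟫ = 0 at horth
  set w := fderiv ℝ (fun y => (M / ‖f y‖) • f y) x v
  rw [real_inner_smul_left, mul_eq_zero, or_iff_right (by positivity),
    real_inner_comm] at horth
  have hw : ‖w‖ ^ 2 = (M / ‖f x‖) * ⟪w, fderiv ℝ f x v⟫ := by
    rw [← real_inner_self_eq_norm_sq]
    nth_rewrite 2 [hprod]
    rw [inner_add_right, real_inner_smul_right, real_inner_smul_right, horth,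
      mul_zero, add_zero]
  rw [hw]
  field_simp

end RadialTruncation

theorem truncation_identity
    (Ω : Set Plane) (hΩ : IsOpen Ω) (A : Plane → V3) (hA : ContDiffOn ℝ 1 A Ω)
    (M : ℝ) (hM : 0 < M) :
    ContDiffOn ℝ 1 (fun x => (M / ‖A x‖) • A x) {x ∈ Ω | M < ‖A x‖} ∧
    ∀ x ∈ {x ∈ Ω | M < ‖A x‖}, ∀ i : Fin 2,
      ⟪fderiv ℝ (fun y => (M / ‖A y‖) • A y) x (EuclideanSpace.single i 1),
        fderiv ℝ A x (EuclideanSpace.single i 1)⟫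
      = (‖A x‖ / M) *
          ‖fderiv ℝ (fun y => (M / ‖A y‖) • A y) x (EuclideanSpace.single i 1)‖ ^ 2 := by
  have hne : ∀ x ∈ {x ∈ Ω | M < ‖A x‖}, A x ≠ 0 := fun x hx =>
    norm_pos_iff.mp (hM.trans hx.2)
  constructor
  · have hA' : ContDiffOn ℝ 1 A {x ∈ Ω | M < ‖A x‖} := hA.mono fun x hx => hx.1
    exact (contDiffOn_const.div (hA'.norm ℝ hne)
      fun x hx => norm_ne_zero_iff.mpr (hne x hx)).smul hA'
  · intro x hx i
    exact inner_fderiv_radial_truncation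
      ((hA.contDiffAt (hΩ.mem_nhds hx.1)).differentiableAt one_ne_zero) (hne x hx) hM _

end
end

section
/- Let U : [0,∞) → [0,∞) be continuously differentiable, let a > 0, and let u : ℝ² → ℝ be a twice continuously differentiable solution of Δu = U'(a²u²) u on ℝ² with finite energy I(u) = ∫_{ℝ²} [ ½|∇u|² + U(a²u²)/(2a²) ] dx < ∞. Then ∫_{ℝ²} U(a²u(x)²) dx = 0. In particular, if U(s) = 0 holds exactly for s = θ² for a single θ² ≥ 0, then a² u(x)² = θ² for every x ∈ ℝ². -/
/-!
The two-dimensional Derrick–Pohozaev rescaling argument: a finite-energy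
solution of Δu = U'(a²u²)u on ℝ² has vanishing potential integral
∫ U(a²u²) = 0; if U vanishes exactly at θ², then a²u² ≡ θ².
-/

open MeasureTheory

noncomputable section

theorem ContDiff.pd {f : Plane → ℝ} {n m : WithTop ℕ∞} (hf : ContDiff ℝ n f) (hmn : m + 1 ≤ n)
    (i : Fin 2) : ContDiff ℝ m (pd i f) :=
  (hf.fderiv_right hmn).clm_apply contDiff_const

theorem pd_add {f g : Plane → ℝ} {x : Plane} (hf : DifferentiableAt ℝ f x)
    (hg : DifferentiableAt ℝ g x) (i : Fin 2) :
    pd i (fun y => f y + g y) x = pd i f x + pd i g x := by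
  simp [pd, fderiv_fun_add hf hg]

theorem pd_sub {f g : Plane → ℝ} {x : Plane} (hf : DifferentiableAt ℝ f x)
    (hg : DifferentiableAt ℝ g x) (i : Fin 2) :
    pd i (fun y => f y - g y) x = pd i f x - pd i g x := by
  simp [pd, fderiv_fun_sub hf hg]

theorem pd_mul {f g : Plane → ℝ} {x : Plane} (hf : DifferentiableAt ℝ f x)
    (hg : DifferentiableAt ℝ g x) (i : Fin 2) :
    pd i (fun y => f y * g y) x = pd i f x * g x + f x * pd i g x := by
  simp [pd, fderiv_fun_mul hf hg]
  ring

theorem pd_comp {W : ℝ → ℝ} {f : Plane → ℝ} {x : Plane} (hW : DifferentiableAt ℝ W (f x))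
    (hf : DifferentiableAt ℝ f x) (i : Fin 2) :
    pd i (fun y => W (f y)) x = deriv W (f x) * pd i f x := by
  have h := (hW.hasDerivAt.comp_hasFDerivAt x hf.hasFDerivAt).fderiv
  change fderiv ℝ (fun y => W (f y)) x = _ at h
  simp [pd, h]

theorem pd_coord (i j : Fin 2) (x : Plane) :
    pd i (fun y => y j) x = if j = i then 1 else 0 := by
  have h : HasFDerivAt (fun y : Plane => y j) (EuclideanSpace.proj j : Plane →L[ℝ] ℝ) x :=
    (EuclideanSpace.proj j : Plane →L[ℝ] ℝ).hasFDerivAt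
  simp [pd, h.fderiv]

theorem pd_comp_smul {f : Plane → ℝ} (hf : Differentiable ℝ f) (t : ℝ) (i : Fin 2) (x : Plane) :
    pd i (fun y => f (t • y)) x = t * pd i f (t • x) := by
  have h : HasFDerivAt (fun y => f (t • y)) _ x :=
    (hf (t • x)).hasFDerivAt.comp x ((hasFDerivAt_id x).const_smul t)
  simp [pd, h.fderiv]

theorem pd_comm {f : Plane → ℝ} (hf : ContDiff ℝ 2 f) (i j : Fin 2) (x : Plane) :
    pd i (pd j f) x = pd j (pd i f) x := by
  have hd : DifferentiableAt ℝ (fderiv ℝ f) x :=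
    (hf.fderiv_right (m := 1) (by norm_num)).differentiable (by norm_num) x
  have h : ∀ k l : Fin 2, pd k (pd l f) x =
      fderiv ℝ (fderiv ℝ f) x (EuclideanSpace.single k 1) (EuclideanSpace.single l 1) := by
    intro k l
    have h := (hd.hasFDerivAt.clm_apply
      (hasFDerivAt_const (EuclideanSpace.single l (1 : ℝ)) x)).fderiv
    change fderiv ℝ (pd l f) x = _ at h
    unfold pd at h ⊢
    simp [h]
  rw [h, h]
  exact (hf.contDiffAt.isSymmSndFDerivAt (by simp)).eq _ _

theorem abs_coord_le_norm (x : Plane) (i : Fin 2) : |x i| ≤ ‖x‖ := by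
  simpa using PiLp.norm_apply_le x i

/-- Integration by parts against a compactly supported function. -/
theorem integral_mul_pd_of_hasCompactSupport {φ T : Plane → ℝ} (hφ : ContDiff ℝ 1 φ)
    (hsupp : HasCompactSupport φ) (hT : ContDiff ℝ 1 T) (i : Fin 2) :
    Integrable (fun x => φ x * pd i T x) ∧ Integrable (fun x => pd i φ x * T x) ∧
      ∫ x, φ x * pd i T x = -∫ x, pd i φ x * T x := by
  have hφ' : Continuous (pd i φ) := (hφ.pd (m := 0) (by norm_num) i).continuous
  have hT' : Continuous (pd i T) := (hT.pd (m := 0) (by norm_num) i).continuous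
  have hsupp' : HasCompactSupport (pd i φ) := hsupp.fderiv_apply ℝ _
  have h₁ : Integrable (fun x => φ x * pd i T x) :=
    (hφ.continuous.mul hT').integrable_of_hasCompactSupport hsupp.mul_right
  have h₂ : Integrable (fun x => pd i φ x * T x) :=
    (hφ'.mul hT.continuous).integrable_of_hasCompactSupport hsupp'.mul_right
  have h₃ : Integrable (fun x => φ x * T x) :=
    (hφ.continuous.mul hT.continuous).integrable_of_hasCompactSupport hsupp.mul_right
  exact ⟨h₁, h₂, integral_mul_fderiv_eq_neg_fderiv_mul_of_integrable h₂ h₁ h₃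
    (fun x _ => hφ.differentiable (by norm_num) x) (fun x _ => hT.differentiable (by norm_num) x)⟩

/-- A `C¹` vector field bounded by `‖x‖` times an integrable function has vanishing total
divergence, provided the divergence is integrable. -/
theorem integral_divergence_eq_zero {T : Fin 2 → Plane → ℝ} (hT : ∀ i, ContDiff ℝ 1 (T i))
    {E : Plane → ℝ} (hE : Integrable E) (hE0 : ∀ x, 0 ≤ E x)
    (hTE : ∀ i x, |T i x| ≤ ‖x‖ * E x)
    (hdiv : Integrable (fun x => pd 0 (T 0) x + pd 1 (T 1) x)) :
    ∫ x, (pd 0 (T 0) x + pd 1 (T 1) x) = 0 := by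
  let ψ : ContDiffBump (0 : Plane) := ⟨1, 2, by norm_num, by norm_num⟩
  have hψ : ContDiff ℝ 1 ψ := ψ.contDiff
  have hψ' : ∀ i, Continuous (pd i ψ) := fun i => (hψ.pd (m := 0) (by norm_num) i).continuous
  have hK : ∀ i, ∃ K, ∀ y : Plane, |pd i ψ y| * ‖y‖ ≤ K := by
    intro i
    have hs : HasCompactSupport (fun y : Plane => |pd i ψ y| * ‖y‖) :=
      ((ψ.hasCompactSupport.fderiv_apply ℝ (EuclideanSpace.single i 1)).comp_left
        (g := fun r : ℝ => |r|) abs_zero).mul_right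
    obtain ⟨K, hK⟩ := ((hψ' i).abs.mul continuous_norm).bounded_above_of_compact_support hs
    exact ⟨K, fun y => (le_abs_self _).trans (hK y)⟩
  choose K hK using hK
  let t : ℕ → ℝ := fun n => 1 / ((n : ℝ) + 1)
  have ht : Filter.Tendsto t Filter.atTop (nhds 0) := tendsto_one_div_add_atTop_nhds_zero_nat
  have ht0 : ∀ n, 0 < t n := fun n => by positivity
  let φ : ℕ → Plane → ℝ := fun n x => ψ (t n • x)
  have hφ : ∀ n, ContDiff ℝ 1 (φ n) := fun n => hψ.comp (contDiff_id.const_smul (t n))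
  have hφs : ∀ n, HasCompactSupport (φ n) := fun n =>
    ψ.hasCompactSupport.comp_homeomorph (Homeomorph.smulOfNeZero (t n) (ht0 n).ne')
  have hty : ∀ x : Plane, Filter.Tendsto (fun n => t n • x) Filter.atTop (nhds 0) := fun x => by
    simpa using ht.smul_const x
  have hlim : Filter.Tendsto (fun n => ∫ x, φ n x * (pd 0 (T 0) x + pd 1 (T 1) x)) Filter.atTop
      (nhds (∫ x, (pd 0 (T 0) x + pd 1 (T 1) x))) := by
    refine tendsto_integral_of_dominated_convergence _
      (fun n => (hφ n).continuous.aestronglyMeasurable.mul hdiv.1) hdiv.norm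
      (fun n => .of_forall fun x => ?_) (.of_forall fun x => ?_)
    · rw [norm_mul, Real.norm_of_nonneg ψ.nonneg]
      exact mul_le_of_le_one_left (norm_nonneg _) ψ.le_one
    · have h := (hψ.continuous.tendsto 0).comp (hty x)
      rw [ψ.one_of_mem_closedBall (by simp [ψ.rIn_pos.le])] at h
      simpa using h.mul_const (pd 0 (T 0) x + pd 1 (T 1) x)
  have hlim' : ∀ i, Filter.Tendsto (fun n => ∫ x, pd i (φ n) x * T i x) Filter.atTop
      (nhds 0) := by
    intro i
    have hpd : ∀ n x, pd i (φ n) x = t n * pd i ψ (t n • x) := fun n x =>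
      pd_comp_smul (hψ.differentiable (by norm_num)) (t n) i x
    rw [← integral_zero Plane ℝ]
    refine tendsto_integral_of_dominated_convergence (fun x => K i * E x)
      (fun n => (integral_mul_pd_of_hasCompactSupport (hφ n) (hφs n) (hT i) i).2.1.1)
      (hE.const_mul _) (fun n => .of_forall fun x => ?_) (.of_forall fun x => ?_)
    · calc
        ‖pd i (φ n) x * T i x‖ = t n * |pd i ψ (t n • x)| * |T i x| := by
            rw [hpd, norm_mul, norm_mul, Real.norm_of_nonneg (ht0 n).le]; rfl
        _ ≤ t n * |pd i ψ (t n • x)| * (‖x‖ * E x) :=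
            mul_le_mul_of_nonneg_left (hTE i x) (mul_nonneg (ht0 n).le (abs_nonneg _))
        _ = |pd i ψ (t n • x)| * ‖t n • x‖ * E x := by
            rw [norm_smul, Real.norm_of_nonneg (ht0 n).le]; ring
        _ ≤ K i * E x := mul_le_mul_of_nonneg_right (hK i _) (hE0 x)
    · have h := (ht.mul (((hψ' i).tendsto 0).comp (hty x))).mul_const (T i x)
      simpa [hpd] using h
  have hparts : ∀ n, ∫ x, φ n x * (pd 0 (T 0) x + pd 1 (T 1) x) =
      -(∫ x, pd 0 (φ n) x * T 0 x) - ∫ x, pd 1 (φ n) x * T 1 x := by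
    intro n
    obtain ⟨h₀, -, e₀⟩ := integral_mul_pd_of_hasCompactSupport (hφ n) (hφs n) (hT 0) 0
    obtain ⟨h₁, -, e₁⟩ := integral_mul_pd_of_hasCompactSupport (hφ n) (hφs n) (hT 1) 1
    simp only [mul_add]
    rw [integral_add h₀ h₁, e₀, e₁, sub_eq_add_neg]
  simp only [hparts] at hlim
  simpa using tendsto_nhds_unique hlim ((hlim' 0).neg.sub (hlim' 1))

/-- The energy density of a field `u` with potential `W`. -/
def energyDensity (W : ℝ → ℝ) (u : Plane → ℝ) (x : Plane) : ℝ :=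
  1 / 2 * (pd 0 u x * pd 0 u x + pd 1 u x * pd 1 u x) + W (u x)

/-- The stress-energy tensor contracted with the generator of dilations. -/
def dilationField (W : ℝ → ℝ) (u : Plane → ℝ) (i : Fin 2) (x : Plane) : ℝ :=
  (x 0 * pd 0 u x + x 1 * pd 1 u x) * pd i u x - x i * energyDensity W u x

theorem contDiff_energyDensity {W : ℝ → ℝ} (hW : ContDiff ℝ 1 W) {u : Plane → ℝ}
    (hu : ContDiff ℝ 2 u) : ContDiff ℝ 1 (energyDensity W u) := by
  have hp : ∀ i, ContDiff ℝ 1 (pd i u) := hu.pd (by norm_num)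
  exact (contDiff_const.mul (((hp 0).mul (hp 0)).add ((hp 1).mul (hp 1)))).add
    (hW.comp (hu.of_le (by norm_num)))

theorem contDiff_dilationField {W : ℝ → ℝ} (hW : ContDiff ℝ 1 W) {u : Plane → ℝ}
    (hu : ContDiff ℝ 2 u) (i : Fin 2) : ContDiff ℝ 1 (dilationField W u i) := by
  have hp : ∀ i, ContDiff ℝ 1 (pd i u) := hu.pd (by norm_num)
  have hx : ∀ j, ContDiff ℝ 1 (fun y : Plane => y j) := fun j =>
    (EuclideanSpace.proj j : Plane →L[ℝ] ℝ).contDiff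
  exact ((((hx 0).mul (hp 0)).add ((hx 1).mul (hp 1))).mul (hp i)).sub
    ((hx i).mul (contDiff_energyDensity hW hu))

theorem divergence_dilationField {W : ℝ → ℝ} (hW : ContDiff ℝ 1 W) {u : Plane → ℝ}
    (hu : ContDiff ℝ 2 u) (heq : ∀ x, lap u x = deriv W (u x)) (x : Plane) :
    pd 0 (dilationField W u 0) x + pd 1 (dilationField W u 1) x = -2 * W (u x) := by
  have hp : ∀ i, DifferentiableAt ℝ (pd i u) x := fun i =>
    (hu.pd (m := 1) (by norm_num) i).differentiable (by norm_num) x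
  have hx : ∀ j, DifferentiableAt ℝ (fun y : Plane => y j) x := fun j =>
    (EuclideanSpace.proj j : Plane →L[ℝ] ℝ).differentiableAt
  have hu' : DifferentiableAt ℝ u x := hu.differentiable (by norm_num) x
  have hW' : DifferentiableAt ℝ W (u x) := hW.differentiable (by norm_num) _
  have hWu : DifferentiableAt ℝ (fun y => W (u y)) x := hW'.comp x hu'
  have hE : DifferentiableAt ℝ (energyDensity W u) x :=
    (contDiff_energyDensity hW hu).differentiable (by norm_num) x
  have hpE : ∀ i, pd i (energyDensity W u) x =
      pd 0 u x * pd i (pd 0 u) x + pd 1 u x * pd i (pd 1 u) x + deriv W (u x) * pd i u x := by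
    intro i
    have hconst : pd i (fun _ => (1 / 2 : ℝ)) x = 0 := by simp [pd]
    have hsq : DifferentiableAt ℝ (fun y => pd 0 u y * pd 0 u y + pd 1 u y * pd 1 u y) x :=
      ((hp 0).fun_mul (hp 0)).fun_add ((hp 1).fun_mul (hp 1))
    unfold energyDensity
    rw [pd_add ((differentiableAt_const _).fun_mul hsq) hWu, pd_mul (differentiableAt_const _) hsq,
      pd_add ((hp 0).fun_mul (hp 0)) ((hp 1).fun_mul (hp 1)), pd_mul (hp 0) (hp 0), pd_mul (hp 1) (hp 1),
      pd_comp hW' hu', hconst]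
    ring
  have hpT : ∀ i, pd i (dilationField W u i) x =
      (pd i (fun y => y 0) x * pd 0 u x + x 0 * pd i (pd 0 u) x +
        (pd i (fun y => y 1) x * pd 1 u x + x 1 * pd i (pd 1 u) x)) * pd i u x +
      (x 0 * pd 0 u x + x 1 * pd 1 u x) * pd i (pd i u) x -
      (energyDensity W u x + x i * pd i (energyDensity W u) x) := by
    intro i
    have h₀ := (hx 0).fun_mul (hp 0)
    have h₁ := (hx 1).fun_mul (hp 1)
    unfold dilationField
    rw [pd_sub ((h₀.fun_add h₁).fun_mul (hp i)) ((hx i).fun_mul hE), pd_mul (h₀.fun_add h₁) (hp i),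
      pd_add h₀ h₁, pd_mul (hx 0) (hp 0), pd_mul (hx 1) (hp 1), pd_mul (hx i) hE, pd_coord i i]
    simp
  have hlap := heq x
  rw [lap] at hlap
  rw [hpT, hpT, hpE, hpE, pd_comm hu 1 0, ← hlap]
  simp only [pd_coord, energyDensity]
  simp
  ring

theorem le_energyDensity (W : ℝ → ℝ) (u : Plane → ℝ) (x : Plane) :
    W (u x) ≤ energyDensity W u x := by
  unfold energyDensity
  nlinarith [mul_self_nonneg (pd 0 u x), mul_self_nonneg (pd 1 u x)]

theorem abs_dilationField_le {W : ℝ → ℝ} (u : Plane → ℝ) (i : Fin 2) (x : Plane)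
    (hW : 0 ≤ W (u x)) : |dilationField W u i x| ≤ ‖x‖ * (4 * energyDensity W u x) := by
  have hE : 0 ≤ energyDensity W u x := hW.trans (le_energyDensity W u x)
  have hprod : |pd 0 u x * pd i u x| + |pd 1 u x * pd i u x| ≤ 3 * energyDensity W u x := by
    have h : |pd 0 u x * pd 1 u x| ≤ energyDensity W u x := by
      unfold energyDensity
      rw [abs_le]
      constructor <;>
        nlinarith [sq_nonneg (pd 0 u x + pd 1 u x), sq_nonneg (pd 0 u x - pd 1 u x)]
    fin_cases i
    · simp only [Fin.zero_eta, abs_mul_self]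
      rw [mul_comm (pd 1 u x)]
      unfold energyDensity at *
      nlinarith [mul_self_nonneg (pd 1 u x)]
    · simp only [Fin.mk_one, abs_mul_self]
      unfold energyDensity at *
      nlinarith [mul_self_nonneg (pd 0 u x)]
  calc |dilationField W u i x|
      = |x 0 * (pd 0 u x * pd i u x) + x 1 * (pd 1 u x * pd i u x) -
          x i * energyDensity W u x| := by
        unfold dilationField; congr 1; ring
    _ ≤ |x 0| * |pd 0 u x * pd i u x| + |x 1| * |pd 1 u x * pd i u x| +
          |x i| * energyDensity W u x := by
        rw [← abs_mul, ← abs_mul, ← abs_of_nonneg hE, ← abs_mul, abs_of_nonneg hE]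
        exact (abs_sub _ _).trans (add_le_add_left (abs_add_le _ _) _)
    _ ≤ ‖x‖ * |pd 0 u x * pd i u x| + ‖x‖ * |pd 1 u x * pd i u x| +
          ‖x‖ * energyDensity W u x := by
        gcongr <;> exact abs_coord_le_norm x _
    _ ≤ ‖x‖ * (4 * energyDensity W u x) := by nlinarith [norm_nonneg x]

/-- The Derrick–Pohozaev identity in the plane. -/
theorem derrick_pohozaev {W : ℝ → ℝ} (hW : ContDiff ℝ 1 W) (hW0 : ∀ s, 0 ≤ W s)
    {u : Plane → ℝ} (hu : ContDiff ℝ 2 u) (heq : ∀ x, lap u x = deriv W (u x))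
    (hfin : Integrable (energyDensity W u)) :
    Integrable (fun x => W (u x)) ∧ ∫ x, W (u x) = 0 := by
  have hWint : Integrable (fun x => W (u x)) := by
    refine hfin.mono' (hW.continuous.comp hu.continuous).aestronglyMeasurable
      (.of_forall fun x => ?_)
    rw [Real.norm_of_nonneg (hW0 _)]
    exact le_energyDensity W u x
  have hdiv := divergence_dilationField hW hu heq
  have h := integral_divergence_eq_zero (contDiff_dilationField hW hu) (hfin.const_mul 4)
    (fun x => mul_nonneg zero_le_four ((hW0 _).trans (le_energyDensity W u x)))
    (fun i x => abs_dilationField_le u i x (hW0 _)) (by simpa only [hdiv] using hWint.const_mul (-2))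
  simp only [hdiv, integral_const_mul] at h
  exact ⟨hWint, by linarith⟩

theorem derrick_rescaling
    (U : ℝ → ℝ) (hU : ContDiff ℝ 1 U) (hUnonneg : ∀ s, 0 ≤ s → 0 ≤ U s)
    (a : ℝ) (ha : 0 < a) (u : Plane → ℝ) (hu : ContDiff ℝ 2 u)
    (heq : ∀ x, lap u x = deriv U (a ^ 2 * u x ^ 2) * u x)
    (hfin : Integrable (fun x =>
        (1 / 2) * ‖gradient u x‖ ^ 2 + U (a ^ 2 * u x ^ 2) / (2 * a ^ 2))) :
    (∫ x, U (a ^ 2 * u x ^ 2)) = 0 ∧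
    ∀ θsq : ℝ, 0 ≤ θsq → (∀ s, 0 ≤ s → (U s = 0 ↔ s = θsq)) →
      ∀ x, a ^ 2 * u x ^ 2 = θsq := by
  have ha2 : (0 : ℝ) < 2 * a ^ 2 := by positivity
  let W : ℝ → ℝ := fun s => U (a ^ 2 * s ^ 2) / (2 * a ^ 2)
  have hW : ContDiff ℝ 1 W :=
    (hU.comp (contDiff_const.mul (contDiff_id.pow 2))).div_const _
  have hW0 : ∀ s, 0 ≤ W s := fun s => div_nonneg (hUnonneg _ (by positivity)) ha2.le
  have hderiv : ∀ s, deriv W s = deriv U (a ^ 2 * s ^ 2) * s := by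
    intro s
    have h : HasDerivAt W _ s :=
      (((hU.differentiable (by norm_num) _).hasDerivAt.comp s
        ((hasDerivAt_pow 2 s).const_mul (a ^ 2))).div_const (2 * a ^ 2))
    rw [h.deriv]
    field_simp
    push_cast
    ring
  have hE : Integrable (energyDensity W u) := by
    refine hfin.congr (.of_forall fun x => ?_)
    simp only [energyDensity, norm_gradient_sq, W, sq (pd _ u x)]
  obtain ⟨hWint, hzero⟩ := derrick_pohozaev hW hW0 hu (fun x => by rw [heq, hderiv]) hE
  have hUeq : ∀ x, U (a ^ 2 * u x ^ 2) = 2 * a ^ 2 * W (u x) := fun x => by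
    simp only [W]; field_simp
  have hUzero : ∫ x, U (a ^ 2 * u x ^ 2) = 0 := by
    simp only [hUeq, integral_const_mul, hzero, mul_zero]
  refine ⟨hUzero, fun θsq _ hθ x => (hθ _ (by positivity)).1 ?_⟩
  have hae := (integral_eq_zero_iff_of_nonneg (fun x => hW0 (u x)) hWint).1 hzero
  have hWu : (fun x => W (u x)) = 0 :=
    (hW.continuous.comp hu.continuous).ae_eq_iff_eq volume continuous_zero |>.1 hae
  rw [hUeq, congrFun hWu x, Pi.zero_apply, mul_zero]

end
end
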